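/- Let γ = 2 and let (u,θ) be a classical solution of the thermal reduced Burgers system on 𝕋³ × [0,T] with θ₀ ≥ 1 on 𝕋³. Then the total kinetic plus thermal energy is conserved: ½‖u(·,t)‖²_{L²(𝕋³)} + ‖θ(·,t)‖²_{L²(𝕋³)} = ½‖u₀‖²_{L²(𝕋³)} + ‖θ₀‖²_{L²(𝕋³)} for all t ∈ [0,T]. -/

import Mathlib

open MeasureTheory Real
open scoped ENNReal

noncomputable section

/-- Points of `ℝ³`; `ℤ³`-periodic functions on `Sp` model functions on the torus `𝕋³`. -/
abbrev Sp : Type := Fin 3 → ℝ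

/-- A fundamental cell for the torus `𝕋³ = ℝ³/ℤ³`; integrals over `𝕋³` are integrals
over `cell`. -/
def cell : Set Sp := Set.Icc 0 1

/-- The `i`-th partial derivative `∂ᵢ f`. -/
def pd (i : Fin 3) (f : Sp → ℝ) (x : Sp) : ℝ := fderiv ℝ f x (Pi.single i 1)

/-- `ℤ³`-periodicity: such a function descends to the torus `𝕋³`. -/
def Periodic3 (f : Sp → ℝ) : Prop :=
  ∀ (x : Sp) (k : Fin 3 → ℤ), f (x + fun i => (k i : ℝ)) = f x

/-- `|∇u|²` for a vector field `u`. -/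
def gradSqV (u : Sp → Fin 3 → ℝ) (x : Sp) : ℝ :=
  ∑ i, ∑ j, (pd i (fun y => u y j) x) ^ 2

/-- `|∇²u|²` for a vector field `u`. -/
def hessSqV (u : Sp → Fin 3 → ℝ) (x : Sp) : ℝ :=
  ∑ i, ∑ j, ∑ k, (pd i (pd j (fun y => u y k)) x) ^ 2

/-- `|∇f|²` for a scalar field `f`. -/
def gradSqS (f : Sp → ℝ) (x : Sp) : ℝ := ∑ i, (pd i f x) ^ 2

/-- A classical solution `(u, θ)` of the thermal reduced Burgers system
`∂ₜuⱼ + uᵢ∂ᵢuⱼ + (1/γ)uⱼ∂ᵢuᵢ − ν∂ᵢ(θ∂ᵢuⱼ) = 0`,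
`∂ₜ(θ²) + ∂ᵢ(uᵢθ²) − κ∂ᵢ(θ∂ᵢ(θ²)) = νθ|∇u|²` on `𝕋³ × [0,T]`, with `θ₀ ≥ 1`. -/
structure ThermalBurgers (ν κ γ T : ℝ) (u : ℝ → Sp → Fin 3 → ℝ)
    (θ : ℝ → Sp → ℝ) : Prop where
  T_pos : 0 < T
  smooth_u : ContDiff ℝ (⊤ : ℕ∞) fun q : ℝ × Sp => u q.1 q.2
  smooth_θ : ContDiff ℝ (⊤ : ℕ∞) fun q : ℝ × Sp => θ q.1 q.2
  periodic_u : ∀ t j, Periodic3 fun x => u t x j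
  periodic_θ : ∀ t, Periodic3 (θ t)
  momentum : ∀ t ∈ Set.Icc (0 : ℝ) T, ∀ x, ∀ j,
    deriv (fun s => u s x j) t
      + (∑ i, u t x i * pd i (fun y => u t y j) x)
      + (1 / γ) * u t x j * (∑ i, pd i (fun y => u t y i) x)
      - ν * ∑ i, pd i (fun y => θ t y * pd i (fun z => u t z j) y) x = 0
  heat : ∀ t ∈ Set.Icc (0 : ℝ) T, ∀ x,
    deriv (fun s => θ s x ^ 2) t
      + (∑ i, pd i (fun y => u t y i * θ t y ^ 2) x)
      - κ * (∑ i, pd i (fun y => θ t y * pd i (fun z => θ t z ^ 2) y) x)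
      = ν * θ t x * gradSqV (u t) x
  θ0_ge_one : ∀ x, 1 ≤ θ 0 x

open scoped ContDiff

/-- Smooth functions on `Sp` are stable under partial derivatives. -/
lemma contDiff_pd {f : Sp → ℝ} (hf : ContDiff ℝ ∞ f) (i : Fin 3) : ContDiff ℝ ∞ (pd i f) :=
  (hf.fderiv_right (m := ∞) le_rfl).clm_apply contDiff_const

lemma Periodic3.pd {f : Sp → ℝ} (hf : Periodic3 f) (i : Fin 3) : Periodic3 (pd i f) := by
  intro x k
  have hshift : (fun y : Sp => f (y + fun i => (k i : ℝ))) = f := funext fun y => hf y k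
  simp only [_root_.pd]
  rw [← fderiv_comp_add_right, hshift]

lemma pd_add {f g : Sp → ℝ} {x : Sp} (i : Fin 3) (hf : DifferentiableAt ℝ f x)
    (hg : DifferentiableAt ℝ g x) : pd i (fun y => f y + g y) x = pd i f x + pd i g x := by
  simp [pd, fderiv_fun_add hf hg]

lemma pd_sub {f g : Sp → ℝ} {x : Sp} (i : Fin 3) (hf : DifferentiableAt ℝ f x)
    (hg : DifferentiableAt ℝ g x) : pd i (fun y => f y - g y) x = pd i f x - pd i g x := by
  simp [pd, fderiv_fun_sub hf hg]

lemma pd_mul {f g : Sp → ℝ} {x : Sp} (i : Fin 3) (hf : DifferentiableAt ℝ f x)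
    (hg : DifferentiableAt ℝ g x) :
    pd i (fun y => f y * g y) x = f x * pd i g x + g x * pd i f x := by
  simp [pd, fderiv_fun_mul hf hg]

lemma pd_const_mul {f : Sp → ℝ} {x : Sp} (i : Fin 3) (c : ℝ) (hf : DifferentiableAt ℝ f x) :
    pd i (fun y => c * f y) x = c * pd i f x := by
  simp [pd, fderiv_const_mul hf]

lemma pd_sum {f : Fin 3 → Sp → ℝ} {x : Sp} (i : Fin 3)
    (hf : ∀ j, DifferentiableAt ℝ (f j) x) :
    pd i (fun y => ∑ j, f j y) x = ∑ j, pd i (f j) x := by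
  simp [pd, fderiv_fun_sum fun j _ => hf j]

/-- The divergence theorem on the torus. -/
lemma integral_cell_sum_pd_eq_zero {F : Fin 3 → Sp → ℝ} (hF : ∀ i, ContDiff ℝ ∞ (F i))
    (hper : ∀ i, Periodic3 (F i)) : ∫ x in cell, ∑ i, pd i (F i) x = 0 := by
  have hint : IntegrableOn (fun x => ∑ i, pd i (F i) x) (Set.Icc (0 : Sp) 1) :=
    (continuous_finsetSum _ fun i _ => (contDiff_pd (hF i) i).continuous).continuousOn
      |>.integrableOn_compact isCompact_Icc
  have hdiv := integral_divergence_of_hasFDerivAt_off_countable' (0 : Sp) 1 zero_le_one F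
    (fun i => fderiv ℝ (F i)) ∅ Set.countable_empty (fun i => (hF i).continuous.continuousOn)
    (fun x _ i => ((hF i).differentiable (by simp) x).hasFDerivAt) hint
  refine hdiv.trans (Finset.sum_eq_zero fun i _ => sub_eq_zero.2 ?_)
  refine integral_congr_ae (.of_forall fun y => ?_)
  have hshift : i.insertNth (α := fun _ => ℝ) ((1 : Sp) i) y
      = i.insertNth (α := fun _ => ℝ) ((0 : Sp) i) y
        + fun j => (((Pi.single i 1 : Fin 3 → ℤ) j : ℤ) : ℝ) := by
    ext j
    refine Fin.succAboveCases i ?_ (fun j => ?_) j <;> simp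
  simp only [hshift, hper i _ _]

/-- If the time derivative of a smooth density integrates to zero at all times in `[0, T]`,
then its integral over the cell is conserved. -/
lemma integral_cell_eq_of_integral_deriv_eq_zero {e : ℝ → Sp → ℝ} {T : ℝ}
    (he : ContDiff ℝ ∞ fun q : ℝ × Sp => e q.1 q.2)
    (hzero : ∀ t ∈ Set.Icc (0 : ℝ) T, ∫ x in cell, deriv (fun s => e s x) t = 0) :
    ∀ t ∈ Set.Icc (0 : ℝ) T, ∫ x in cell, e t x = ∫ x in cell, e 0 x := by
  intro t ht
  let D : ℝ × Sp → ℝ := fun q => fderiv ℝ (fun q : ℝ × Sp => e q.1 q.2) q (1, 0)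
  have hDcont : Continuous D := (he.continuous_fderiv (by simp)).clm_apply continuous_const
  have hderiv (s : ℝ) (x : Sp) : HasDerivAt (fun s => e s x) (D (s, x)) s := by
    have hline : HasDerivAt (fun r : ℝ => (r, x)) ((1 : ℝ), (0 : Sp)) s :=
      (hasDerivAt_id s).prodMk (hasDerivAt_const s x)
    exact ((he.differentiable (by simp) (s, x)).hasFDerivAt).comp_hasDerivAt s hline
  have hslice (s : ℝ) : IntegrableOn (e s) cell :=
    ((he.continuous.comp (by fun_prop : Continuous fun x : Sp => (s, x))).continuousOn
      |>.integrableOn_compact isCompact_Icc)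
  have hprod : Integrable (Function.uncurry fun s x => D (s, x))
      ((volume.restrict (Set.uIoc 0 t)).prod (volume.restrict cell)) := by
    rw [Measure.prod_restrict]
    refine IntegrableOn.mono_set (t := Set.uIcc 0 t ×ˢ cell) ?_
      (Set.prod_mono Set.uIoc_subset_uIcc subset_rfl)
    exact hDcont.continuousOn.integrableOn_compact (isCompact_uIcc.prod isCompact_Icc)
  have hswap := intervalIntegral_integral_swap hprod
  have hleft : ∫ s in (0 : ℝ)..t, ∫ x in cell, D (s, x) = 0 := by
    refine (intervalIntegral.integral_congr (g := fun _ => (0 : ℝ)) fun s hs => ?_).trans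
      (by simp)
    rw [Set.uIcc_of_le ht.1] at hs
    simpa only [(hderiv _ _).deriv] using hzero s ⟨hs.1, hs.2.trans ht.2⟩
  have hright (x : Sp) : ∫ s in (0 : ℝ)..t, D (s, x) = e t x - e 0 x :=
    intervalIntegral.integral_eq_sub_of_hasDerivAt (fun s _ => hderiv s x)
      ((by fun_prop : Continuous fun s => D (s, x)).intervalIntegrable 0 t)
  rw [hleft] at hswap
  simp only [hright] at hswap
  rw [integral_sub (hslice t) (hslice 0)] at hswap
  linarith

/-- The energy flux of the thermal reduced Burgers system for `γ = 2`. -/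
def energyFlux (ν κ : ℝ) (v : Sp → Fin 3 → ℝ) (w : Sp → ℝ) (i : Fin 3) (x : Sp) : ℝ :=
  ν * (∑ j, v x j * (w x * pd i (fun z => v z j) x))
    + κ * (w x * pd i (fun z => w z ^ 2) x)
    - v x i * w x ^ 2 - 1 / 2 * (v x i * ∑ j, v x j * v x j)

section Flux

variable {ν κ : ℝ} {v : Sp → Fin 3 → ℝ} {w : Sp → ℝ}

lemma contDiff_energyFlux (hv : ∀ j, ContDiff ℝ ∞ fun x => v x j) (hw : ContDiff ℝ ∞ w)
    (i : Fin 3) : ContDiff ℝ ∞ (energyFlux ν κ v w i) := by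
  have hdv (j : Fin 3) := contDiff_pd (hv j) i
  have hdw := contDiff_pd (hw.pow 2) i
  unfold energyFlux
  fun_prop

lemma periodic_energyFlux (hv : ∀ j, Periodic3 fun x => v x j) (hw : Periodic3 w)
    (i : Fin 3) : Periodic3 (energyFlux ν κ v w i) := by
  intro x k
  have hw2 : Periodic3 fun z => w z ^ 2 := fun x k => congrArg (· ^ 2) (hw x k)
  have hvk (j : Fin 3) := hv j x k
  have hdvk (j : Fin 3) := (hv j).pd i x k
  simp only at hvk
  simp only [energyFlux, hvk, hdvk, hw x k, hw2.pd i x k]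

lemma pd_energyFlux (hv : ∀ j, ContDiff ℝ ∞ fun x => v x j) (hw : ContDiff ℝ ∞ w)
    (i : Fin 3) (x : Sp) :
    pd i (energyFlux ν κ v w i) x
      = ν * (∑ j, (v x j * pd i (fun y => w y * pd i (fun z => v z j) y) x
          + w x * pd i (fun z => v z j) x * pd i (fun z => v z j) x))
        + κ * pd i (fun y => w y * pd i (fun z => w z ^ 2) y) x
        - pd i (fun y => v y i * w y ^ 2) x
        - 1 / 2 * (v x i * (∑ j, (v x j * pd i (fun z => v z j) x
            + v x j * pd i (fun z => v z j) x))
          + (∑ j, v x j * v x j) * pd i (fun z => v z i) x) := by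
  have hdv (j : Fin 3) : Differentiable ℝ fun x => v x j := (hv j).differentiable (by simp)
  have hdw : Differentiable ℝ w := hw.differentiable (by simp)
  have hddv (j : Fin 3) : Differentiable ℝ (pd i fun z => v z j) :=
    (contDiff_pd (hv j) i).differentiable (by simp)
  have hddw : Differentiable ℝ (pd i fun z => w z ^ 2) :=
    (contDiff_pd (hw.pow 2) i).differentiable (by simp)
  unfold energyFlux
  rw [pd_sub i (by fun_prop) (by fun_prop), pd_sub i (by fun_prop) (by fun_prop),
    pd_add i (by fun_prop) (by fun_prop), pd_const_mul i ν (by fun_prop),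
    pd_const_mul i κ (by fun_prop), pd_const_mul i (1 / 2) (by fun_prop),
    pd_mul (f := fun y => v y i) (g := fun y => ∑ j, v y j * v y j) i (by fun_prop) (by fun_prop),
    pd_sum i fun j => by fun_prop, pd_sum i fun j => by fun_prop]
  congr! 5 with j _ j _
  · exact pd_mul i (hdv j x) (by fun_prop)
  · exact pd_mul i (hdv _ x) (hdv _ x)

end Flux

/-- The local energy balance: the energy density evolves by the divergence of the flux. -/
lemma ThermalBurgers.deriv_energy {ν κ T : ℝ} {u : ℝ → Sp → Fin 3 → ℝ} {θ : ℝ → Sp → ℝ}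
    (h : ThermalBurgers ν κ 2 T u θ) {t : ℝ} (ht : t ∈ Set.Icc (0 : ℝ) T) (x : Sp) :
    deriv (fun s => 1 / 2 * (∑ j, u s x j ^ 2) + θ s x ^ 2) t
      = ∑ i, pd i (energyFlux ν κ (u t) (θ t) i) x := by
  have hu (j : Fin 3) : ContDiff ℝ ∞ fun q : ℝ × Sp => u q.1 q.2 j := contDiff_pi.1 h.smooth_u j
  have hut (j : Fin 3) : Differentiable ℝ fun s => u s x j :=
    ((hu j).comp (by fun_prop : ContDiff ℝ ∞ fun s : ℝ => (s, x))).differentiable (by simp)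
  have hθt : Differentiable ℝ fun s => θ s x :=
    (h.smooth_θ.comp (by fun_prop : ContDiff ℝ ∞ fun s : ℝ => (s, x))).differentiable (by simp)
  have hux (j : Fin 3) : ContDiff ℝ ∞ fun y => u t y j :=
    (hu j).comp (by fun_prop : ContDiff ℝ ∞ fun y : Sp => (t, y))
  have hθx : ContDiff ℝ ∞ (θ t) :=
    h.smooth_θ.comp (by fun_prop : ContDiff ℝ ∞ fun y : Sp => (t, y))
  have hsq : HasDerivAt (fun s => 1 / 2 * (∑ j, u s x j ^ 2) + θ s x ^ 2)
      (1 / 2 * (∑ j, 2 * u t x j * deriv (fun s => u s x j) t)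
        + deriv (fun s => θ s x ^ 2) t) t := by
    refine ((HasDerivAt.fun_sum fun j _ => ?_).const_mul _).add
      (hθt.pow 2 t).hasDerivAt
    simpa using (hut j t).hasDerivAt.fun_pow 2
  rw [hsq.deriv]
  simp only [pd_energyFlux hux hθx]
  have hm0 := h.momentum t ht x 0
  have hm1 := h.momentum t ht x 1
  have hm2 := h.momentum t ht x 2
  have hh := h.heat t ht x
  simp only [gradSqV, Fin.sum_univ_three] at hm0 hm1 hm2 hh ⊢
  linear_combination u t x 0 * hm0 + u t x 1 * hm1 + u t x 2 * hm2 + hh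

/-- **Energy conservation for `γ = 2`, thermal reduced Burgers.**
`½‖u(t)‖²_{L²} + ‖θ(t)‖²_{L²} = ½‖u₀‖²_{L²} + ‖θ₀‖²_{L²}` for all `t ∈ [0,T]`. -/
theorem thermalBurgers_energy_conservation_gamma_two (ν κ T : ℝ) (hν : 0 < ν)
    (hκ : 0 < κ) (u : ℝ → Sp → Fin 3 → ℝ) (θ : ℝ → Sp → ℝ)
    (h : ThermalBurgers ν κ 2 T u θ) :
    ∀ t ∈ Set.Icc (0 : ℝ) T,
      (1 / 2) * (∫ x in cell, ∑ j, u t x j ^ 2) + (∫ x in cell, θ t x ^ 2)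
        = (1 / 2) * (∫ x in cell, ∑ j, u 0 x j ^ 2) + ∫ x in cell, θ 0 x ^ 2 := by
  have hu (j : Fin 3) : ContDiff ℝ ∞ fun q : ℝ × Sp => u q.1 q.2 j := contDiff_pi.1 h.smooth_u j
  have hθ : ContDiff ℝ ∞ fun q : ℝ × Sp => θ q.1 q.2 := h.smooth_θ
  have hux (t : ℝ) (j : Fin 3) : ContDiff ℝ ∞ fun y => u t y j :=
    (hu j).comp (by fun_prop : ContDiff ℝ ∞ fun y : Sp => (t, y))
  have hθx (t : ℝ) : ContDiff ℝ ∞ (θ t) :=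
    hθ.comp (by fun_prop : ContDiff ℝ ∞ fun y : Sp => (t, y))
  have hsplit (t : ℝ) :
      (1 / 2) * (∫ x in cell, ∑ j, u t x j ^ 2) + (∫ x in cell, θ t x ^ 2)
        = ∫ x in cell, (1 / 2 * (∑ j, u t x j ^ 2) + θ t x ^ 2) := by
    have hcu (j : Fin 3) := (hux t j).continuous
    have hcθ := (hθx t).continuous
    rw [integral_add, integral_const_mul]
    · exact (by fun_prop : Continuous fun x => 1 / 2 * ∑ j, u t x j ^ 2).continuousOn
        |>.integrableOn_compact isCompact_Icc
    · exact (by fun_prop : Continuous fun x => θ t x ^ 2).continuousOn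
        |>.integrableOn_compact isCompact_Icc
  intro t ht
  rw [hsplit, hsplit]
  refine integral_cell_eq_of_integral_deriv_eq_zero (T := T)
    (e := fun t x => 1 / 2 * (∑ j, u t x j ^ 2) + θ t x ^ 2) (by fun_prop) (fun s hs => ?_) t ht
  simp only [h.deriv_energy hs]
  exact integral_cell_sum_pd_eq_zero (contDiff_energyFlux (hux s) (hθx s))
    (periodic_energyFlux (h.periodic_u s) (h.periodic_θ s))
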